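/- Let S(N) = Σ_{a,b ≥ 1, ab ≤ N} τ(gcd(a,b)), where τ is the number-of-divisors function, let γ be the Euler–Mascheroni constant, and let θ = Σ_{d=1}^∞ (log d)/d². Then S(N) = ζ(2) N log N + ((2γ−1)ζ(2) − 2θ) N + O(√N), i.e. there exists a constant C > 0 such that for every positive integer N, |S(N) − ζ(2) N log N − ((2γ−1)ζ(2) − 2θ) N| ≤ C √N. -/

import Mathlib

open Finset Real

/-- The sawtooth function `t ↦ {t} - 1/2`. -/
noncomputable def sawtooth (t : ℝ) : ℝ := Int.fract t - 1 / 2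

lemma abs_sawtooth_le (t : ℝ) : |sawtooth t| ≤ 1 / 2 := by
  have h0 := Int.fract_nonneg t
  have h1 := Int.fract_lt_one t
  rw [sawtooth, abs_le]
  constructor <;> linarith

lemma sum_range_emod_of_isCoprime (n p : ℤ) {q : ℕ} (hq : 0 < q) (hpq : IsCoprime p (q : ℤ)) :
    ∑ j ∈ range q, (n + p * j) % (q : ℤ) = ∑ r ∈ range q, (r : ℤ) := by
  have hq' : (0 : ℤ) < q := by exact_mod_cast hq
  set i : ℕ → ℕ := fun j => ((n + p * j) % (q : ℤ)).toNat with hi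
  have hcast : ∀ j, ((i j : ℕ) : ℤ) = (n + p * j) % (q : ℤ) := fun j =>
    Int.toNat_of_nonneg (Int.emod_nonneg _ hq'.ne')
  have hmaps : ∀ j ∈ range q, i j ∈ range q := fun j _ => by
    have := Int.emod_lt_of_pos (n + p * j) hq'
    rw [mem_range]
    have := hcast j
    omega
  have hinj : Set.InjOn i (range q : Set ℕ) := by
    intro a ha b hb hab
    have h1 : (n + p * a) % (q : ℤ) = (n + p * b) % (q : ℤ) := by
      rw [← hcast, ← hcast, hab]
    have h2 : (q : ℤ) ∣ p * (b - a) := by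
      have : (q : ℤ) ∣ (n + p * b) - (n + p * a) := Int.ModEq.dvd h1
      convert! this using 1
      ring
    have h3 : (q : ℤ) ∣ (b - a : ℤ) := hpq.symm.dvd_of_dvd_mul_left h2
    have ha' := mem_range.1 ha
    have hb' := mem_range.1 hb
    have h4 : (b - a : ℤ) = 0 := Int.eq_zero_of_abs_lt_dvd h3 (by rw [abs_lt]; omega)
    omega
  refine sum_nbij i hmaps hinj ?_ (fun j _ => (hcast j).symm)
  exact Finset.surjOn_of_injOn_of_card_le i hmaps hinj le_rfl

lemma abs_sum_sawtooth_arith_le (β : ℝ) (p : ℤ) {q : ℕ} (hq : 0 < q)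
    (hpq : IsCoprime p (q : ℤ)) :
    |∑ j ∈ range q, sawtooth (β + p * j / q)| ≤ 1 / 2 := by
  have hq' : (0 : ℝ) < q := by exact_mod_cast hq
  have hqz : (0 : ℤ) < q := by exact_mod_cast hq
  set n := ⌊(q : ℝ) * β⌋
  set φ := Int.fract ((q : ℝ) * β) with hφ
  have hβ : (q : ℝ) * β = n + φ := (Int.floor_add_fract _).symm
  have h0 : 0 ≤ φ := Int.fract_nonneg _
  have h1 : φ < 1 := Int.fract_lt_one _
  have key : ∀ j : ℕ, Int.fract (β + p * j / q) =
      ((((n + p * j) % (q : ℤ) : ℤ) : ℝ) + φ) / q := by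
    intro j
    rw [Int.fract_eq_iff]
    have e0 := Int.emod_nonneg (n + p * j) hqz.ne'
    have e1 := Int.emod_lt_of_pos (n + p * j) hqz
    have e0' : (0 : ℝ) ≤ (((n + p * j) % (q : ℤ) : ℤ) : ℝ) := by exact_mod_cast e0
    have e1' : (((n + p * j) % (q : ℤ) : ℤ) : ℝ) + 1 ≤ q := by exact_mod_cast e1
    refine ⟨by positivity, by rw [div_lt_one hq']; linarith, (n + p * j) / (q : ℤ), ?_⟩
    have e2 : (((n + p * j) % (q : ℤ) : ℤ) : ℝ) +
        q * (((n + p * j) / (q : ℤ) : ℤ) : ℝ) = n + p * j := by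
      exact_mod_cast Int.emod_add_mul_ediv (n + p * j) (q : ℤ)
    field_simp
    linarith
  have hsum : (∑ j ∈ range q, (((n + p * j) % (q : ℤ) : ℤ) : ℝ)) = q * (q - 1) / 2 := by
    have h2 := sum_range_emod_of_isCoprime n p hq hpq
    have h3 : (∑ r ∈ range q, (r : ℝ)) * 2 = q * (q - 1) := by
      have := Finset.sum_range_id_mul_two q
      have h4 : ((∑ r ∈ range q, r : ℕ) : ℝ) * 2 = q * ((q - 1 : ℕ) : ℝ) := by exact_mod_cast this
      rw [Nat.cast_sub hq] at h4
      push_cast at h4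
      exact h4
    have h5 : (∑ j ∈ range q, (((n + p * j) % (q : ℤ) : ℤ) : ℝ)) = ∑ r ∈ range q, (r : ℝ) := by
      rw [← Int.cast_sum, h2]
      push_cast
      rfl
    rw [h5]; linarith
  have : ∑ j ∈ range q, sawtooth (β + p * j / q) = φ - 1 / 2 := by
    simp only [sawtooth, key]
    rw [sum_sub_distrib, ← sum_div, sum_add_distrib, hsum]
    simp
    field_simp
    ring
  rw [this, abs_le]
  constructor <;> linarith

lemma abs_sum_sawtooth_perturbed_le (β : ℝ) (p : ℤ) {q : ℕ} (hq : 0 < q)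
    (hpq : IsCoprime p (q : ℤ)) (c : ℝ) (e : ℕ → ℝ) (he : ∀ j < q, |e j| ≤ c / q) :
    |∑ j ∈ range q, sawtooth (β + p * j / q + e j)| ≤ 1 / 2 + 2 * c := by
  have hq' : (0 : ℝ) < q := by exact_mod_cast hq
  have hconst : ∑ _j ∈ range q, 2 * (c / q) = 2 * c := by
    simp; field_simp
  have hlow := abs_le.1 (abs_sum_sawtooth_arith_le (β + c / q) p hq hpq)
  have hupp := abs_le.1 (abs_sum_sawtooth_arith_le (β - c / q) p hq hpq)
  rw [abs_le]
  constructor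
  · have : ∑ j ∈ range q, (sawtooth (β + c / q + p * j / q) - 2 * (c / q)) ≤
        ∑ j ∈ range q, sawtooth (β + p * j / q + e j) := by
      refine sum_le_sum fun j hj => ?_
      have h := abs_le.1 (he j (mem_range.1 hj))
      have hm : (⌊β + p * j / q + e j⌋ : ℝ) ≤ ⌊β + c / q + p * j / q⌋ := by
        exact_mod_cast Int.floor_mono (by linarith)
      simp only [sawtooth, Int.fract]
      linarith
    rw [sum_sub_distrib, hconst] at this
    linarith
  · have : ∑ j ∈ range q, sawtooth (β + p * j / q + e j) ≤
        ∑ j ∈ range q, (sawtooth (β - c / q + p * j / q) + 2 * (c / q)) := by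
      refine sum_le_sum fun j hj => ?_
      have h := abs_le.1 (he j (mem_range.1 hj))
      have hm : (⌊β - c / q + p * j / q⌋ : ℝ) ≤ ⌊β + p * j / q + e j⌋ := by
        exact_mod_cast Int.floor_mono (by linarith)
      simp only [sawtooth, Int.fract]
      linarith
    rw [sum_add_distrib, hconst] at this
    linarith

lemma abs_sum_Ico_le_of_blocks (g : ℕ → ℝ) (hg : ∀ n, |g n| ≤ 1) (B : ℕ → Prop) [DecidablePred B]
    {K Q : ℕ} {c : ℝ} (hK : 0 < K) (hc : 0 ≤ c) (a b : ℕ)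
    (hB : ∀ m, a ≤ m → ¬ B m → ∃ q, K < q ∧ q ≤ Q ∧ |∑ j ∈ range q, g (m + j)| ≤ c) :
    |∑ n ∈ Ico a b, g n| ≤ #{n ∈ Ico a b | B n} + c * (b - a : ℕ) / K + Q := by
  have hK' : (0 : ℝ) < K := by exact_mod_cast hK
  induction h : b - a using Nat.strong_induction_on generalizing a with
  | _ l ih =>
  rcases Nat.lt_or_ge a b with hab | hab
  swap
  · rw [Ico_eq_empty (by omega)]
    simp
    positivity
  by_cases hBa : B a
  · have ih' := ih (b - (a + 1)) (by omega) (a := a + 1) (fun m hm => hB m (by omega)) rfl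
    have hcard : #{n ∈ Ico a b | B n} = #{n ∈ Ico (a + 1) b | B n} + 1 := by
      rw [← Finset.insert_Ico_add_one_left_eq_Ico hab, filter_insert, if_pos hBa,
        card_insert_of_notMem (by simp)]
    rw [Finset.sum_eq_sum_Ico_succ_bot hab, hcard]
    push_cast
    have h2 : c * ((b - (a + 1) : ℕ) : ℝ) / K ≤ c * (l : ℝ) / K := by
      gcongr; omega
    have := abs_add_le (g a) (∑ n ∈ Ico (a + 1) b, g n)
    have := hg a
    linarith
  · obtain ⟨q, hKq, hqQ, hq⟩ := hB a le_rfl hBa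
    rcases Nat.lt_or_ge b (a + q) with hlt | hge
    · have h1 : |∑ n ∈ Ico a b, g n| ≤ ∑ n ∈ Ico a b, (1 : ℝ) :=
        (abs_sum_le_sum_abs _ _).trans (sum_le_sum fun n _ => hg n)
      have h2 : (∑ n ∈ Ico a b, (1 : ℝ)) ≤ Q := by
        simp only [sum_const, Nat.card_Ico, nsmul_eq_mul, mul_one]
        exact_mod_cast (by omega)
      have : 0 ≤ c * (l : ℝ) / K := by positivity
      have : (0 : ℝ) ≤ #{n ∈ Ico a b | B n} := by positivity
      linarith
    · have ih' := ih (b - (a + q)) (by omega) (a := a + q) (fun m hm => hB m (by omega)) rfl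
      rw [← sum_Ico_consecutive g (Nat.le_add_right a q) hge]
      have h1 : ∑ n ∈ Ico a (a + q), g n = ∑ j ∈ range q, g (a + j) := by
        rw [sum_Ico_eq_sum_range]; simp
      have h2 : (#{n ∈ Ico (a + q) b | B n} : ℝ) ≤ #{n ∈ Ico a b | B n} := by
        exact_mod_cast card_le_card (filter_subset_filter _ (Ico_subset_Ico_left (by omega)))
      have h3 : c * ((b - (a + q) : ℕ) : ℝ) / K + c ≤ c * (l : ℝ) / K := by
        have : ((b - (a + q) : ℕ) : ℝ) + K ≤ l := by exact_mod_cast (by omega)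
        calc c * ((b - (a + q) : ℕ) : ℝ) / K + c = c * (((b - (a + q) : ℕ) : ℝ) + K) / K := by
              field_simp
          _ ≤ _ := by gcongr
      rw [h1]
      have := abs_add_le (∑ j ∈ range q, g (a + j)) (∑ n ∈ Ico (a + q) b, g n)
      linarith

lemma exists_rat_sum_sawtooth_div_le {x : ℝ} (hx : 0 ≤ x) {m Q : ℕ} (hm : 0 < m) (hQ : 0 < Q)
    (h : x * Q ^ 3 ≤ 4 * m ^ 3) :
    ∃ r : ℚ, |-x / m ^ 2 - r| ≤ 1 / ((Q + 1) * r.den) ∧ r.den ≤ Q ∧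
      |∑ j ∈ range r.den, sawtooth (x / (m + j : ℕ))| ≤ 21 / 2 := by
  obtain ⟨r, hr, hrQ⟩ := Real.exists_rat_abs_sub_le_and_den_le (-x / m ^ 2) hQ
  refine ⟨r, hr, hrQ, ?_⟩
  have hm' : (0 : ℝ) < m := by exact_mod_cast hm
  have hq' : (0 : ℝ) < r.den := by exact_mod_cast r.den_pos
  have hqQ : (r.den : ℝ) ≤ Q := by exact_mod_cast hrQ
  have hcop : IsCoprime r.num (r.den : ℤ) := Rat.isCoprime_num_den r
  have hrr : (r : ℝ) = r.num / r.den := Rat.cast_def r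
  have key := abs_sum_sawtooth_perturbed_le (x / m) r.num r.den_pos hcop 5
    (fun j => (-x / m ^ 2 - r) * j + x * j ^ 2 / (m ^ 2 * (m + j))) ?_
  · norm_num at key
    convert! key using 4 with j hj
    rw [hrr]
    push_cast
    field_simp
    ring
  · intro j hj
    have hj' : (j : ℝ) ≤ r.den := by exact_mod_cast hj.le
    have h1 : |(-x / m ^ 2 - r) * j| ≤ 1 / r.den := by
      rw [abs_mul, Nat.abs_cast]
      calc |-x / m ^ 2 - r| * j ≤ 1 / ((Q + 1) * r.den) * Q := by
            gcongr; linarith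
        _ ≤ 1 / r.den := by
            rw [div_mul_eq_mul_div, div_le_div_iff₀ (by positivity) hq']
            nlinarith
    have h2 : |x * j ^ 2 / (m ^ 2 * (m + j))| ≤ 4 / r.den := by
      rw [abs_of_nonneg (by positivity)]
      calc x * j ^ 2 / (m ^ 2 * (m + j)) ≤ x * r.den ^ 2 / (m ^ 2 * (m + 0)) := by
            gcongr; positivity
        _ = x * r.den ^ 3 / m ^ 3 / r.den := by field_simp; ring
        _ ≤ x * Q ^ 3 / m ^ 3 / r.den := by gcongr
        _ ≤ 4 / r.den := by
            gcongr
            rwa [div_le_iff₀ (by positivity)]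
    have : (5 : ℝ) / r.den = 1 / r.den + 4 / r.den := by ring
    rw [this]
    exact (abs_add_le _ _).trans (add_le_add h1 h2)

lemma card_le_of_forall_sub_le (s : Finset ℕ) {W : ℝ} (hW : 0 ≤ W)
    (h : ∀ m ∈ s, ∀ n ∈ s, m < n → (n : ℝ) - m ≤ W) : (#s : ℝ) ≤ W + 1 := by
  rcases s.eq_empty_or_nonempty with rfl | hs
  · simp; linarith
  · have hsub : s ⊆ Icc (s.min' hs) (s.max' hs) := fun n hn =>
      mem_Icc.2 ⟨s.min'_le n hn, s.le_max' n hn⟩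
    have hle := card_le_card hsub
    rw [Nat.card_Icc] at hle
    have hmm : s.min' hs ≤ s.max' hs := s.min'_le _ (s.max'_mem hs)
    have h1 : (#s : ℝ) ≤ (s.max' hs : ℝ) - s.min' hs + 1 := by
      have : #s + s.min' hs ≤ s.max' hs + 1 := by omega
      have : (#s : ℝ) + s.min' hs ≤ s.max' hs + 1 := by exact_mod_cast this
      linarith
    rcases hmm.lt_or_eq with hlt | heq
    · have := h _ (s.min'_mem hs) _ (s.max'_mem hs) hlt
      linarith
    · rw [heq] at h1
      linarith

lemma card_near_integer_le {x : ℝ} {a s Q q : ℕ} (ha : 0 < a) (hs : (s : ℝ) ^ 2 ≤ x)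
    (hq : 0 < q) (p : ℝ) :
    (#({m ∈ Ico a (s + 1) | |q * x / (m : ℝ) ^ 2 - p| ≤ 1 / ((Q : ℝ) + 1)} : Finset ℕ) : ℝ) ≤
      2 * s / ((Q + 1) * q) + 1 := by
  refine card_le_of_forall_sub_le _ (by positivity) ?_
  intro m hm n hn hmn
  simp only [mem_filter, mem_Ico] at hm hn
  obtain ⟨⟨hm0, hm1⟩, hm2⟩ := hm
  obtain ⟨⟨hn0, hn1⟩, hn2⟩ := hn
  have hm' : (0 : ℝ) < m := by exact_mod_cast (by omega)
  have hn' : (0 : ℝ) < n := by exact_mod_cast (by omega)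
  have hs' : (0 : ℝ) < s := by exact_mod_cast (by omega)
  have hq' : (0 : ℝ) < q := by exact_mod_cast hq
  have hms : (m : ℝ) ≤ s := by exact_mod_cast (by omega)
  have hns : (n : ℝ) ≤ s := by exact_mod_cast (by omega)
  have hmn' : (m : ℝ) < n := by exact_mod_cast hmn
  have h1 : q * x / (m : ℝ) ^ 2 - q * x / (n : ℝ) ^ 2 ≤ 2 / (Q + 1) := by
    have := abs_le.1 hm2
    have := abs_le.1 hn2
    have : (2 : ℝ) / (Q + 1) = 1 / (Q + 1) + 1 / (Q + 1) := by ring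
    linarith
  have h2 : q * (n - m) / s ≤ q * x / (m : ℝ) ^ 2 - q * x / (n : ℝ) ^ 2 := by
    have e : q * x / (m : ℝ) ^ 2 - q * x / (n : ℝ) ^ 2 =
        q * (n - m) * (x * (n + m) / (m ^ 2 * n ^ 2)) := by
      field_simp; ring
    have h3 : 1 / (s : ℝ) ≤ x * (n + m) / (m ^ 2 * n ^ 2) := by
      rw [div_le_div_iff₀ hs' (by positivity)]
      calc 1 * ((m : ℝ) ^ 2 * n ^ 2) = m * m * (n * n) := by ring
        _ ≤ m * s * (s * s) := by gcongr
        _ = (s : ℝ) ^ 2 * m * s := by ring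
        _ ≤ x * (n + m) * s := by
            gcongr
            · nlinarith
            · linarith
    rw [e]
    calc q * (n - m) / (s : ℝ) = q * (n - m) * (1 / s) := by ring
      _ ≤ _ := mul_le_mul_of_nonneg_left h3 (mul_nonneg hq'.le (by linarith))
  have h4 := h2.trans h1
  rw [div_le_div_iff₀ hs' (by positivity)] at h4
  rw [le_div_iff₀ (by positivity)]
  linarith

lemma card_near_rational_le {x : ℝ} {a s Q K T : ℕ} (ha : 0 < a) (hs : (s : ℝ) ^ 2 ≤ x)
    (hQ : 0 < Q) (hT : 0 < T) (hx : x ≤ 4 * (s : ℝ) ^ 2) (haT : s ≤ a * T) (B : ℕ → Prop) [DecidablePred B]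
    (hB : ∀ m, B m → ∃ r : ℚ, |-x / (m : ℝ) ^ 2 - r| ≤ 1 / (((Q : ℝ) + 1) * r.den) ∧ r.den ≤ K) :
    (#{m ∈ Ico a (s + 1) | B m} : ℝ) ≤ 10 * T ^ 2 * K * s / (Q + 1) + 5 * T ^ 2 * K ^ 2 := by
  classical
  have hsub : {m ∈ Ico a (s + 1) | B m} ⊆ (Icc 1 K).biUnion fun q =>
      (range (4 * q * T ^ 2 + 1)).biUnion fun p =>
        {m ∈ Ico a (s + 1) | |q * x / (m : ℝ) ^ 2 - (p : ℝ)| ≤ 1 / ((Q : ℝ) + 1)} := by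
    intro m hm
    obtain ⟨hm1, hm2⟩ := mem_filter.1 hm
    obtain ⟨r, hr, hrK⟩ := hB m hm2
    have hm3 := mem_Ico.1 hm1
    have hm' : (0 : ℝ) < m := by exact_mod_cast (by omega)
    have hq' : (0 : ℝ) < r.den := by exact_mod_cast r.den_pos
    have hrr : (r : ℝ) = r.num / r.den := Rat.cast_def r
    have h1 : |r.den * x / (m : ℝ) ^ 2 - ((-r.num : ℤ) : ℝ)| ≤ 1 / ((Q : ℝ) + 1) := by
      have e : r.den * x / (m : ℝ) ^ 2 - ((-r.num : ℤ) : ℝ) =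
          -(r.den * (-x / (m : ℝ) ^ 2 - r)) := by
        rw [hrr]; push_cast; field_simp; ring
      rw [e, abs_neg, abs_mul, Nat.abs_cast]
      calc (r.den : ℝ) * |-x / (m : ℝ) ^ 2 - r| ≤ r.den * (1 / (((Q : ℝ) + 1) * r.den)) := by
            gcongr
        _ = _ := by field_simp
    have h1' := abs_le.1 h1
    have hx0 : 0 ≤ x := le_trans (by positivity) hs
    have h2 : 0 ≤ r.den * x / (m : ℝ) ^ 2 := by positivity
    have h3 : r.den * x / (m : ℝ) ^ 2 ≤ 4 * r.den * T ^ 2 := by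
      rw [div_le_iff₀ (by positivity)]
      have hsT : (s : ℝ) ≤ m * T := by
        exact_mod_cast haT.trans (Nat.mul_le_mul_right T hm3.1)
      calc r.den * x ≤ r.den * (4 * (s : ℝ) ^ 2) := by gcongr
        _ ≤ r.den * (4 * (m * T : ℝ) ^ 2) := by gcongr
        _ = _ := by ring
    have h4 : 1 / ((Q : ℝ) + 1) < 1 := by
      have : (0 : ℝ) < Q := by exact_mod_cast hQ
      rw [div_lt_one (by positivity)]; linarith
    obtain ⟨p, hp⟩ : ∃ p : ℕ, -r.num = p := by
      refine Int.eq_ofNat_of_zero_le ?_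
      have : ((-1 : ℤ) : ℝ) < ((-r.num : ℤ) : ℝ) := by push_cast at h1' ⊢; linarith
      have : (-1 : ℤ) < -r.num := by exact_mod_cast this
      omega
    rw [hp] at h1 h1'
    simp only [mem_biUnion, mem_filter, mem_Icc, mem_range]
    refine ⟨r.den, ⟨r.den_pos, hrK⟩, p, ?_, hm1, by simpa using h1⟩
    have : (p : ℝ) < 4 * r.den * T ^ 2 + 1 := by push_cast at h1'; linarith
    exact_mod_cast this
  have hcard : (#{m ∈ Ico a (s + 1) | B m} : ℝ) ≤ ∑ q ∈ Icc 1 K,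
      (10 * T ^ 2 * s / (Q + 1) + 5 * T ^ 2 * K : ℝ) := by
    refine (Nat.cast_le.2 ((card_le_card hsub).trans card_biUnion_le)).trans ?_
    rw [Nat.cast_sum]
    refine sum_le_sum fun q hq => ?_
    obtain ⟨hq1, hqK⟩ := mem_Icc.1 hq
    have hq' : (1 : ℝ) ≤ q := by exact_mod_cast hq1
    have hqK' : (q : ℝ) ≤ K := by exact_mod_cast hqK
    have hT' : (1 : ℝ) ≤ T := by exact_mod_cast hT
    refine (Nat.cast_le.2 card_biUnion_le).trans ?_
    rw [Nat.cast_sum]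
    refine (sum_le_sum fun (p : ℕ) _ =>
      card_near_integer_le (Q := Q) ha hs hq1 (p : ℝ)).trans ?_
    rw [sum_const, card_range, nsmul_eq_mul]
    push_cast
    have : (4 * q * T ^ 2 + 1 : ℝ) ≤ 5 * q * T ^ 2 := by
      have : (1 : ℝ) ≤ q * T ^ 2 := one_le_mul_of_one_le_of_one_le hq' (one_le_pow₀ hT')
      linarith
    calc (4 * q * T ^ 2 + 1 : ℝ) * (2 * s / ((Q + 1) * q) + 1)
        ≤ 5 * q * T ^ 2 * (2 * s / ((Q + 1) * q) + 1) := by gcongr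
      _ = 10 * T ^ 2 * s / (Q + 1) + 5 * T ^ 2 * q := by field_simp; ring
      _ ≤ _ := by gcongr
  refine hcard.trans (le_of_eq ?_)
  rw [sum_const, Nat.card_Icc, nsmul_eq_mul]
  simp only [Nat.add_sub_cancel]
  ring

/-- Saving a factor `k` over the trivial bound for the sawtooth sum of the divisor problem. -/
lemma abs_sum_sawtooth_div_le {x : ℝ} {s k : ℕ} (hk : 0 < k) (hks : k ^ 15 ≤ s)
    (hs : (s : ℝ) ^ 2 ≤ x) (hx : x ≤ 4 * (s : ℝ) ^ 2) :
    |∑ n ∈ Ico 1 (s + 1), sawtooth (x / n)| ≤ 28 * s / k := by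
  classical
  have hk' : (0 : ℝ) < k := by exact_mod_cast hk
  have hk1 : (1 : ℝ) ≤ k := by exact_mod_cast hk
  have hks' : (k : ℝ) ^ 15 ≤ s := by exact_mod_cast hks
  have hx0 : 0 ≤ x := le_trans (by positivity) hs
  set a := s / k + 1 with ha
  have hak : s ≤ a * k := by
    have := Nat.lt_div_mul_add (a := s) hk
    rw [ha]; linarith
  have hapos : 0 < a := Nat.succ_pos _
  have hak' : (s : ℝ) ≤ a * k := by exact_mod_cast hak
  have has : a ≤ s + 1 := by
    have := Nat.div_le_self s k
    omega
  set B : ℕ → Prop := fun m => ∃ r : ℚ,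
    |-x / (m : ℝ) ^ 2 - r| ≤ 1 / ((((k ^ 4 : ℕ) : ℝ) + 1) * r.den) ∧ r.den ≤ k with hB
  have hcard := card_near_rational_le (a := a) (Q := k ^ 4) hapos hs (by positivity) hk hx hak B fun m h => h
  have hblocks := abs_sum_Ico_le_of_blocks (fun n => sawtooth (x / n))
    (fun n => (abs_sawtooth_le _).trans (by norm_num)) B (Q := k ^ 4) (c := 21 / 2) hk
    (by norm_num) a (s + 1) (by
      intro m hm hBm
      have hQ : x * ((k ^ 4 : ℕ) : ℝ) ^ 3 ≤ 4 * m ^ 3 := by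
        have h1 : (s : ℝ) ≤ m * k := hak'.trans (by gcongr)
        refine le_of_mul_le_mul_right ?_ (pow_pos hk' 3)
        push_cast
        calc x * ((k : ℝ) ^ 4) ^ 3 * k ^ 3 ≤ 4 * (s : ℝ) ^ 2 * ((k : ℝ) ^ 4) ^ 3 * k ^ 3 := by gcongr
          _ = 4 * (s : ℝ) ^ 2 * k ^ 15 := by ring
          _ ≤ 4 * (s : ℝ) ^ 2 * s := by gcongr
          _ = 4 * (s : ℝ) ^ 3 := by ring
          _ ≤ 4 * (m * k : ℝ) ^ 3 := by gcongr
          _ = _ := by ring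
      obtain ⟨r, h1, h2, h3⟩ := exists_rat_sum_sawtooth_div_le hx0 (m := m) (hapos.trans_le hm)
        (Q := k ^ 4) (by positivity) hQ
      refine ⟨r.den, ?_, h2, h3⟩
      by_contra! hcon
      exact hBm ⟨r, h1, hcon⟩)
  rw [← sum_Ico_consecutive _ hapos has]
  have hinit : |∑ n ∈ Ico 1 a, sawtooth (x / n)| ≤ (s : ℝ) / k / 2 := by
    calc _ ≤ ∑ n ∈ Ico 1 a, (1 / 2 : ℝ) :=
          (abs_sum_le_sum_abs _ _).trans (sum_le_sum fun n _ => abs_sawtooth_le _)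
      _ = ((s / k : ℕ) : ℝ) / 2 := by
          rw [sum_const, Nat.card_Ico, nsmul_eq_mul, ha]; simp; ring
      _ ≤ _ := by gcongr; exact Nat.cast_div_le
  have hlen : (21 / 2 : ℝ) * ((s + 1 - a : ℕ) : ℝ) / k ≤ 21 / 2 * s / k := by
    have : s + 1 - a ≤ s := by omega
    gcongr
  have hpow : ∀ i ≤ 14, (k : ℝ) ^ i ≤ s / k := by
    intro i hi
    rw [le_div_iff₀ hk', ← pow_succ]
    exact (pow_le_pow_right₀ hk1 (by omega)).trans hks'
  have h4 := hpow 4 (by norm_num)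
  have h1 : (10 * k ^ 2 * k * s / (((k ^ 4 : ℕ) : ℝ) + 1) : ℝ) ≤ 10 * (s / k) := by
    rw [div_le_iff₀ (by positivity)]
    push_cast
    have : 10 * ((s : ℝ) / k) * (k ^ 4 + 1) = 10 * k ^ 2 * k * s + 10 * (s / k) := by
      field_simp
    rw [this]
    have : (0 : ℝ) ≤ s / k := by positivity
    linarith
  have h5 : (5 * k ^ 2 * k ^ 2 : ℝ) ≤ 5 * (s / k) := by
    calc (5 * k ^ 2 * k ^ 2 : ℝ) = 5 * k ^ 4 := by ring
      _ ≤ _ := by gcongr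
  have := abs_add_le (∑ n ∈ Ico 1 a, sawtooth (x / n)) (∑ n ∈ Ico a (s + 1), sawtooth (x / n))
  push_cast at hblocks hcard h1
  have e1 : (28 * s / k : ℝ) = 28 * (s / k) := by ring
  have e2 : (21 / 2 * s / k : ℝ) = 21 / 2 * (s / k) := by ring
  rw [e1]
  rw [e2] at hlen
  linarith

open Filter Topology in
lemma abs_harmonic_sub_log_sub_le {n : ℕ} (hn : 0 < n) :
    |(harmonic n : ℝ) - Real.log n - 1 / (2 * n) - eulerMascheroniConstant| ≤ 1 / (n : ℝ) ^ 2 := by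
  set u : ℕ → ℝ := fun n => (harmonic n : ℝ) - Real.log n - 1 / (2 * n) with hu
  have hstep : ∀ m : ℕ, 0 < m →
      |u m - u (m + 1)| ≤ 1 / (m : ℝ) ^ 2 - 1 / ((m + 1 : ℕ) : ℝ) ^ 2 := by
    intro m hm
    have hm' : (0 : ℝ) < m := by exact_mod_cast hm
    have h := Real.abs_log_sub_add_sum_range_le (x := 1 / ((m : ℝ) + 1))
      (by rw [abs_of_pos (by positivity), div_lt_one (by positivity)]; linarith) 2
    have hlog : Real.log (1 - 1 / ((m : ℝ) + 1)) = Real.log m - Real.log (m + 1) := by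
      rw [← Real.log_div (by positivity) (by positivity)]
      congr 1; field_simp; ring
    rw [hlog, abs_of_pos (show (0 : ℝ) < 1 / ((m : ℝ) + 1) by positivity)] at h
    set S := ∑ i ∈ range 2, (1 / ((m : ℝ) + 1)) ^ (i + 1) / ((i : ℝ) + 1) +
      (Real.log m - Real.log (m + 1)) with hS
    have e : u m - u (m + 1) = -S - 1 / (2 * m * ((m : ℝ) + 1) ^ 2) := by
      simp only [hu, hS, harmonic_succ, sum_range_succ, sum_range_zero]
      push_cast
      field_simp
      ring
    have h' : (1 / ((m : ℝ) + 1)) ^ (2 + 1) / (1 - 1 / ((m : ℝ) + 1)) =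
        1 / (m * ((m : ℝ) + 1) ^ 2) := by
      have : 1 - 1 / ((m : ℝ) + 1) = m / (m + 1) := by field_simp; ring
      rw [this, div_pow, one_pow]
      field_simp
    rw [h'] at h
    have h2 : 1 / (m * ((m : ℝ) + 1) ^ 2) + 1 / (2 * m * ((m : ℝ) + 1) ^ 2) ≤
        1 / (m : ℝ) ^ 2 - 1 / ((m + 1 : ℕ) : ℝ) ^ 2 := by
      have : 1 / (m : ℝ) ^ 2 - 1 / ((m + 1 : ℕ) : ℝ) ^ 2 -
          (1 / (m * ((m : ℝ) + 1) ^ 2) + 1 / (2 * m * ((m : ℝ) + 1) ^ 2)) =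
          (m / 2 + 1) / (m ^ 2 * (m + 1) ^ 2) := by
        push_cast
        field_simp
        ring
      have : (0 : ℝ) ≤ (m / 2 + 1) / (m ^ 2 * (m + 1) ^ 2) := by positivity
      linarith
    have h3 : (0 : ℝ) ≤ 1 / (2 * m * ((m : ℝ) + 1) ^ 2) := by positivity
    rw [e]
    rw [abs_le] at h ⊢
    constructor <;> linarith
  have hlim : Tendsto u atTop (𝓝 eulerMascheroniConstant) := by
    have h1 : Tendsto (fun n : ℕ => (1 : ℝ) / (2 * n)) atTop (𝓝 0) := by
      have := (tendsto_one_div_atTop_nhds_zero_nat (𝕜 := ℝ)).const_mul (1 / 2)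
      simp only [mul_zero] at this
      refine this.congr fun n => ?_
      rw [one_div, one_div, one_div, mul_inv]
    have h2 := Real.tendsto_eulerMascheroniSeq'.sub h1
    rw [sub_zero] at h2
    refine h2.congr' ?_
    filter_upwards [eventually_gt_atTop 0] with m hm
    simp [hu, Real.eulerMascheroniSeq', hm.ne']
  have hdiff : ∀ m ≥ n, |u n - u m| ≤ 1 / (n : ℝ) ^ 2 - 1 / (m : ℝ) ^ 2 := by
    intro m hm
    induction m, hm using Nat.le_induction with
    | base => simp
    | succ m hm ih =>
      have := abs_sub_le (u n) (u m) (u (m + 1))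
      have := hstep m (hn.trans_le hm)
      linarith
  refine le_of_tendsto (tendsto_const_nhds.sub hlim).abs ?_
  filter_upwards [eventually_ge_atTop n] with m hm
  have := hdiff m hm
  have : (0 : ℝ) ≤ 1 / (m : ℝ) ^ 2 := by positivity
  linarith

/-- The number of pairs of positive integers with product at most `M`. -/
noncomputable def divisorSum (M : ℕ) : ℕ :=
  #{p ∈ Icc 1 M ×ˢ Icc 1 M | p.1 * p.2 ≤ M}

lemma divisorSum_hyperbola (M : ℕ) :
    divisorSum M + Nat.sqrt M ^ 2 = 2 * ∑ a ∈ Icc 1 (Nat.sqrt M), M / a := by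
  set s := Nat.sqrt M with hs
  have hsM : s ≤ M := Nat.sqrt_le_self M
  have hss : s * s ≤ M := Nat.sqrt_le M
  have hsl : ∀ n, n ≤ s ↔ n * n ≤ M := fun n => Nat.le_sqrt
  set P : Finset (ℕ × ℕ) := {p ∈ Icc 1 M ×ˢ Icc 1 M | p.1 * p.2 ≤ M} with hP
  have hunion : P = {p ∈ P | p.1 ≤ s} ∪ {p ∈ P | p.2 ≤ s} := by
    rw [← filter_or]
    refine (filter_true_of_mem fun p hp => ?_).symm
    by_contra! hcon
    have h1 := (mem_filter.1 hp).2
    have h2 : (s + 1) * (s + 1) ≤ M := (Nat.mul_le_mul hcon.1 hcon.2).trans h1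
    have := (hsl _).2 h2
    omega
  have hinter : {p ∈ P | p.1 ≤ s} ∩ {p ∈ P | p.2 ≤ s} = Icc 1 s ×ˢ Icc 1 s := by
    ext ⟨a, b⟩
    simp only [hP, mem_inter, mem_filter, mem_product, mem_Icc]
    constructor
    · rintro ⟨⟨⟨⟨⟨ha, -⟩, hb, -⟩, -⟩, has⟩, -, hbs⟩
      exact ⟨⟨ha, has⟩, hb, hbs⟩
    · rintro ⟨⟨ha, has⟩, hb, hbs⟩
      have : a * b ≤ M := (Nat.mul_le_mul has hbs).trans hss
      refine ⟨⟨⟨⟨⟨ha, by omega⟩, hb, by omega⟩, this⟩, has⟩, ⟨⟨⟨ha, by omega⟩, hb, by omega⟩, this⟩, hbs⟩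
  have hfst : #{p ∈ P | p.1 ≤ s} = ∑ a ∈ Icc 1 s, M / a := by
    have : ({p ∈ P | p.1 ≤ s} : Finset (ℕ × ℕ)) = ((Icc 1 s).sigma (fun a => Icc 1 (M / a))).map
        (Equiv.sigmaEquivProd ℕ ℕ).toEmbedding := by
      ext ⟨a, b⟩
      simp only [hP, mem_filter, mem_product, mem_Icc, mem_map_equiv, mem_sigma,
        Equiv.sigmaEquivProd_symm_apply]
      constructor
      · rintro ⟨⟨⟨⟨ha, -⟩, hb, -⟩, hab⟩, has⟩
        exact ⟨⟨ha, has⟩, hb, (Nat.le_div_iff_mul_le ha).2 (by linarith)⟩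
      · rintro ⟨⟨ha, has⟩, hb, hab⟩
        rw [Nat.le_div_iff_mul_le ha] at hab
        refine ⟨⟨⟨⟨ha, by omega⟩, hb, ?_⟩, by linarith⟩, has⟩
        nlinarith
    rw [this, card_map, card_sigma]
    simp
  have hsnd : #{p ∈ P | p.2 ≤ s} = #{p ∈ P | p.1 ≤ s} := by
    refine card_bij (fun p _ => p.swap) ?_ (fun _ _ _ _ h => Prod.swap_injective h) ?_
    · rintro ⟨a, b⟩ h
      simp only [hP, mem_filter, mem_product, Prod.swap] at h ⊢
      exact ⟨⟨⟨h.1.1.2, h.1.1.1⟩, by linarith [h.1.2]⟩, h.2⟩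
    · rintro ⟨a, b⟩ h
      refine ⟨(b, a), ?_, rfl⟩
      simp only [hP, mem_filter, mem_product] at h ⊢
      exact ⟨⟨⟨h.1.1.2, h.1.1.1⟩, by linarith [h.1.2]⟩, h.2⟩
  have h := card_union_add_card_inter {p ∈ P | p.1 ≤ s} {p ∈ P | p.2 ≤ s}
  rw [← hunion, hinter, hsnd, hfst] at h
  have hcard : #(Icc 1 s ×ˢ Icc 1 s) = s ^ 2 := by simp [sq]
  rw [hcard] at h
  rw [divisorSum, h]
  ring

lemma divisorSum_eq_sawtooth (M : ℕ) :
    (divisorSum M : ℝ) = 2 * M * (harmonic (Nat.sqrt M) : ℝ) - Nat.sqrt M - (Nat.sqrt M : ℝ) ^ 2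
      - 2 * ∑ n ∈ Ico 1 (Nat.sqrt M + 1), sawtooth ((M : ℝ) / n) := by
  set s := Nat.sqrt M
  have h : (divisorSum M : ℝ) + (s : ℝ) ^ 2 = 2 * ∑ a ∈ Icc 1 s, ((M / a : ℕ) : ℝ) := by
    exact_mod_cast divisorSum_hyperbola M
  have h1 : ∀ a : ℕ, ((M / a : ℕ) : ℝ) = M * (a : ℝ)⁻¹ - 1 / 2 - sawtooth ((M : ℝ) / a) := by
    intro a
    have : ⌊(M : ℝ) / a⌋ = ((M / a : ℕ) : ℤ) := by
      rw [← Int.natCast_floor_eq_floor (by positivity), Nat.floor_div_eq_div]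
    rw [sawtooth, Int.fract, this, Int.cast_natCast]
    ring
  have h2 : (harmonic s : ℝ) = ∑ a ∈ Icc 1 s, (a : ℝ)⁻¹ := by
    rw [harmonic_eq_sum_Icc]; push_cast; rfl
  have h3 : Ico 1 (s + 1) = Icc 1 s := by ext; simp
  simp only [h1, sum_sub_distrib, ← mul_sum, ← h2] at h
  simp only [sum_const, Nat.card_Icc, Nat.add_sub_cancel, nsmul_eq_mul] at h
  rw [h3]
  linarith

lemma abs_hyperbola_main_sub_le {M : ℕ} (hM : 0 < M) :
    |2 * M * (harmonic (Nat.sqrt M) : ℝ) - Nat.sqrt M - (Nat.sqrt M : ℝ) ^ 2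
      - (M * Real.log M + (2 * eulerMascheroniConstant - 1) * M)| ≤ 16 := by
  set s := Nat.sqrt M with hs
  have hs0 : 0 < s := Nat.sqrt_pos.2 hM
  have hs' : (1 : ℝ) ≤ s := by exact_mod_cast hs0
  have hspos : (0 : ℝ) < s := by linarith
  obtain ⟨r, hr⟩ : ∃ r, M = s ^ 2 + r := Nat.exists_eq_add_of_le (Nat.sqrt_le' M)
  have hr2 : r ≤ 2 * s := by
    have := Nat.sqrt_le_add M
    rw [← hs] at this
    nlinarith
  have hr' : (r : ℝ) ≤ 2 * s := by exact_mod_cast hr2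
  have hr0 : (0 : ℝ) ≤ r := by positivity
  have hMr : (M : ℝ) = s ^ 2 + r := by exact_mod_cast hr
  have hM3 : (M : ℝ) ≤ 3 * s ^ 2 := by nlinarith
  have hM0 : (0 : ℝ) ≤ M := by positivity
  set t : ℝ := r / s ^ 2 with ht
  have ht0 : 0 ≤ t := by positivity
  have hlog : Real.log M = 2 * Real.log s + Real.log (1 + t) := by
    have : (M : ℝ) = s ^ 2 * (1 + t) := by rw [hMr, ht]; field_simp
    rw [this, Real.log_mul (by positivity) (by positivity), Real.log_pow]
    push_cast; ring
  have hupp : Real.log (1 + t) ≤ t := by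
    have := Real.log_le_sub_one_of_pos (show 0 < 1 + t by positivity)
    linarith
  have hlow : t - t ^ 2 / 2 ≤ Real.log (1 + t) := by
    refine le_trans ?_ (Real.le_log_one_add_of_nonneg ht0)
    rw [le_div_iff₀ (by positivity)]
    have : 0 ≤ t ^ 3 := by positivity
    nlinarith
  have hMt : M * t ^ 2 ≤ 12 := by
    have : M * t ^ 2 = M * r ^ 2 / (s ^ 2) ^ 2 := by rw [ht]; field_simp
    rw [this, div_le_iff₀ (by positivity)]
    calc (M : ℝ) * r ^ 2 ≤ 3 * s ^ 2 * (2 * s) ^ 2 := by gcongr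
      _ = _ := by ring
  set ε := (harmonic s : ℝ) - Real.log s - 1 / (2 * s) - eulerMascheroniConstant with hε
  have hεb : |M * ε| ≤ 3 := by
    rw [abs_mul, Nat.abs_cast]
    calc (M : ℝ) * |ε| ≤ 3 * s ^ 2 * (1 / s ^ 2) := by
          gcongr; exact abs_harmonic_sub_log_sub_le hs0
      _ = 3 := by field_simp
  have hH : (harmonic s : ℝ) = Real.log s + 1 / (2 * s) + eulerMascheroniConstant + ε := by
    rw [hε]; ring
  have e : 2 * M * (harmonic s : ℝ) - s - (s : ℝ) ^ 2
      - (M * Real.log M + (2 * eulerMascheroniConstant - 1) * M) =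
      2 * (M * ε) + (r / s - (r / s) ^ 2) - M * (Real.log (1 + t) - t) := by
    have : (r / s - (r / s) ^ 2 : ℝ) = M / s - s + (M - s ^ 2) - M * t := by
      rw [ht, hMr]; field_simp; ring
    rw [this, hH, hlog]
    field_simp
    ring
  have hrs : (r : ℝ) / s ≤ 2 := by rwa [div_le_iff₀ hspos]
  have hrs0 : (0 : ℝ) ≤ r / s := by positivity
  have h1 : M * (Real.log (1 + t) - t) ≤ 0 :=
    mul_nonpos_of_nonneg_of_nonpos hM0 (by linarith)
  have h2 : -6 ≤ M * (Real.log (1 + t) - t) := by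
    have : M * (-(t ^ 2 / 2)) ≤ M * (Real.log (1 + t) - t) := by gcongr; linarith
    linarith
  have h3 : (r / s : ℝ) ^ 2 ≤ 4 := by nlinarith
  have h4 := abs_le.1 hεb
  rw [e, abs_le]
  constructor <;> nlinarith

/-- Dirichlet's divisor problem with an error term of exponent smaller than `1/2`. -/
lemma abs_divisorSum_sub_le {M : ℕ} (hM : 0 < M) :
    |(divisorSum M : ℝ) - (M * Real.log M + (2 * eulerMascheroniConstant - 1) * M)| ≤
      144 * (M : ℝ) ^ (7 / 15 : ℝ) := by
  set s := Nat.sqrt M with hs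
  have hs0 : 0 < s := Nat.sqrt_pos.2 hM
  have hs' : (1 : ℝ) ≤ s := by exact_mod_cast hs0
  set y : ℝ := (s : ℝ) ^ (1 / 15 : ℝ) with hy
  have hy1 : 1 ≤ y := Real.one_le_rpow hs' (by norm_num)
  have hy15 : y ^ 15 = s := by
    rw [hy, ← Real.rpow_natCast, ← Real.rpow_mul (by positivity)]
    norm_num
  set k := ⌊y⌋₊ with hk
  have hk0 : 0 < k := Nat.floor_pos.2 hy1
  have hk1 : (1 : ℝ) ≤ k := by exact_mod_cast hk0
  have hky : (k : ℝ) ≤ y := Nat.floor_le (by positivity)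
  have hyk : y ≤ 2 * k := by
    have := Nat.lt_floor_add_one y
    linarith
  have hks : k ^ 15 ≤ s := by
    have : (k : ℝ) ^ 15 ≤ s := by rw [← hy15]; gcongr
    exact_mod_cast this
  have hsM : (s : ℝ) ^ 2 ≤ M := by exact_mod_cast Nat.sqrt_le' M
  have hMs : (M : ℝ) ≤ 4 * (s : ℝ) ^ 2 := by
    have h : M ≤ s * s + s + s := Nat.sqrt_le_add M
    have : (M : ℝ) ≤ s * s + s + s := by exact_mod_cast h
    nlinarith
  have h1 := abs_le.1 (abs_sum_sawtooth_div_le hk0 hks hsM hMs)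
  have h2 := abs_le.1 (abs_hyperbola_main_sub_le hM)
  rw [← hs] at h2
  have hsk : (1 : ℝ) ≤ s / k := by
    rw [le_div_iff₀ (by positivity), one_mul]
    calc (k : ℝ) ≤ k ^ 15 := le_self_pow₀ hk1 (by norm_num)
      _ ≤ s := by exact_mod_cast hks
  have hsk2 : (s : ℝ) / k ≤ 2 * (M : ℝ) ^ (7 / 15 : ℝ) := by
    have h3 : y ^ 14 ≤ (M : ℝ) ^ (7 / 15 : ℝ) := by
      calc y ^ 14 = ((s : ℝ) ^ 2) ^ (7 / 15 : ℝ) := by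
            rw [hy, ← Real.rpow_natCast, ← Real.rpow_mul (by positivity), ← Real.rpow_natCast,
              ← Real.rpow_mul (by positivity)]
            norm_num
        _ ≤ _ := by gcongr
    rw [div_le_iff₀ (by positivity), ← hy15]
    calc y ^ 15 = y ^ 14 * y := by ring
      _ ≤ (M : ℝ) ^ (7 / 15 : ℝ) * (2 * k) := by gcongr
      _ = _ := by ring
  rw [divisorSum_eq_sawtooth, ← hs]
  have e : (28 * s / k : ℝ) = 28 * (s / k) := by ring
  rw [e] at h1
  rw [abs_le]
  constructor <;> linarith

lemma abs_divisorSum_floor_sub_le {x : ℝ} (hx : 1 ≤ x) :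
    |(divisorSum ⌊x⌋₊ : ℝ) - x * (Real.log x + (2 * eulerMascheroniConstant - 1))| ≤
      150 * x ^ (7 / 15 : ℝ) := by
  set M := ⌊x⌋₊
  have hM : 0 < M := Nat.floor_pos.2 hx
  have hM1 : (1 : ℝ) ≤ M := by exact_mod_cast hM
  have hMx : (M : ℝ) ≤ x := Nat.floor_le (by linarith)
  have hxM : x < M + 1 := Nat.lt_floor_add_one x
  have h := abs_le.1 (abs_divisorSum_sub_le hM)
  have h1 : (M : ℝ) ^ (7 / 15 : ℝ) ≤ x ^ (7 / 15 : ℝ) := by gcongr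
  have h2 : 1 ≤ x ^ (7 / 15 : ℝ) := Real.one_le_rpow hx (by norm_num)
  have h3 : Real.log x ≤ x ^ (7 / 15 : ℝ) / (7 / 15) :=
    Real.log_le_rpow_div (by linarith) (by norm_num)
  have h4 : Real.log M ≤ Real.log x := Real.log_le_log (by linarith) hMx
  have h5 : Real.log x - Real.log M ≤ (x - M) / M := by
    rw [← Real.log_div (by linarith) (by linarith)]
    have := Real.log_le_sub_one_of_pos (show 0 < x / M by positivity)
    have e : (x - M) / M = x / M - 1 := by field_simp
    linarith
  have h6 : M * (Real.log x - Real.log M) ≤ 1 := by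
    calc M * (Real.log x - Real.log M) ≤ M * ((x - M) / M) := by gcongr
      _ = x - M := by field_simp
      _ ≤ 1 := by linarith
  have h6' : 0 ≤ M * (Real.log x - Real.log M) := mul_nonneg (by linarith) (by linarith)
  have h7 : 0 ≤ Real.log x := Real.log_nonneg hx
  have h8 : (x - M) * Real.log x ≤ 1 * Real.log x := by gcongr; linarith
  have h8' : 0 ≤ (x - M) * Real.log x := mul_nonneg (by linarith) h7
  have hγ := Real.one_half_lt_eulerMascheroniConstant
  have hγ' := Real.eulerMascheroniConstant_lt_two_thirds
  have h9 : (x - M) * (2 * eulerMascheroniConstant - 1) ≤ 1 * 1 := by gcongr <;> linarith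
  have h9' : 0 ≤ (x - M) * (2 * eulerMascheroniConstant - 1) :=
    mul_nonneg (by linarith) (by linarith)
  rw [abs_le]
  constructor <;> linarith

lemma sum_card_divisors_gcd_eq (N : ℕ) :
    ∑ p ∈ ((Finset.Icc 1 N) ×ˢ (Finset.Icc 1 N)).filter (fun p => p.1 * p.2 ≤ N),
      (Nat.gcd p.1 p.2).divisors.card = ∑ d ∈ Icc 1 (Nat.sqrt N), divisorSum (N / d ^ 2) := by
  set P : Finset (ℕ × ℕ) := {p ∈ Icc 1 N ×ˢ Icc 1 N | p.1 * p.2 ≤ N} with hP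
  have h1 : ∀ p ∈ P, (Nat.gcd p.1 p.2).divisors.card =
      ∑ d ∈ Icc 1 (Nat.sqrt N), if d ∣ p.1 ∧ d ∣ p.2 then 1 else 0 := by
    rintro ⟨a, b⟩ hp
    simp only [hP, mem_filter, mem_product, mem_Icc] at hp
    rw [← card_filter]
    congr 1
    ext d
    simp only [Nat.mem_divisors, Nat.dvd_gcd_iff, mem_filter, mem_Icc]
    constructor
    · rintro ⟨⟨hda, hdb⟩, -⟩
      refine ⟨⟨Nat.pos_of_dvd_of_pos hda hp.1.1.1, Nat.le_sqrt.2 ?_⟩, hda, hdb⟩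
      exact (Nat.mul_le_mul (Nat.le_of_dvd hp.1.1.1 hda) (Nat.le_of_dvd hp.1.2.1 hdb)).trans hp.2
    · rintro ⟨-, hd⟩
      exact ⟨hd, (Nat.gcd_pos_of_pos_left _ hp.1.1.1).ne'⟩
  rw [sum_congr rfl h1, sum_comm]
  refine sum_congr rfl fun d hd => ?_
  have hd0 : 0 < d := (mem_Icc.1 hd).1
  have hd2 : 0 < d ^ 2 := by positivity
  rw [← card_filter, divisorSum]
  symm
  refine card_bij (fun p _ => (d * p.1, d * p.2)) ?_ ?_ ?_
  · rintro ⟨a, b⟩ h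
    simp only [hP, mem_filter, mem_product, mem_Icc, Nat.le_div_iff_mul_le hd2] at h ⊢
    obtain ⟨⟨⟨ha, -⟩, hb, -⟩, hab⟩ := h
    have h2 : d * a * (d * b) ≤ N := by linarith
    have h3 : 0 < d * a := by positivity
    have h4 : 0 < d * b := by positivity
    exact ⟨⟨⟨⟨h3, by nlinarith⟩, h4, by nlinarith⟩, h2⟩, Nat.dvd_mul_right _ _,
      Nat.dvd_mul_right _ _⟩
  · rintro ⟨a, b⟩ - ⟨a', b'⟩ - h
    simp only [Prod.mk.injEq] at h ⊢
    exact ⟨Nat.eq_of_mul_eq_mul_left hd0 h.1, Nat.eq_of_mul_eq_mul_left hd0 h.2⟩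
  · rintro ⟨a, b⟩ h
    simp only [hP, mem_filter, mem_product, mem_Icc] at h
    obtain ⟨⟨⟨⟨ha, -⟩, hb, -⟩, hab⟩, ⟨a', rfl⟩, ⟨b', rfl⟩⟩ := h
    have ha' : 0 < a' := Nat.pos_of_mul_pos_left ha
    have hb' : 0 < b' := Nat.pos_of_mul_pos_left hb
    refine ⟨(a', b'), ?_, rfl⟩
    have h2 : a' * b' ≤ N / d ^ 2 := by
      rw [Nat.le_div_iff_mul_le hd2]; linarith
    simp only [mem_filter, mem_product, mem_Icc]
    exact ⟨⟨⟨ha', by nlinarith⟩, hb', by nlinarith⟩, h2⟩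

lemma sum_Icc_rpow_neg_le (R : ℕ) :
    ∑ d ∈ Icc 1 R, (d : ℝ) ^ (-(14 / 15) : ℝ) ≤ 15 * (R : ℝ) ^ (1 / 15 : ℝ) := by
  induction R with
  | zero => simp
  | succ n ih =>
    rw [sum_Icc_succ_top (by omega)]
    have hn : (0 : ℝ) < (n + 1 : ℕ) := by positivity
    have h := rpow_one_add_le_one_add_mul_self (s := -(1 / ((n + 1 : ℕ) : ℝ)))
      (by rw [neg_le_neg_iff, div_le_one hn]; push_cast; linarith [n.cast_nonneg (α := ℝ)])
      (p := 1 / 15) (by norm_num) (by norm_num)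
    have e : (n : ℝ) = ((n + 1 : ℕ) : ℝ) * (1 + -(1 / ((n + 1 : ℕ) : ℝ))) := by
      push_cast; field_simp; ring
    have hpos : 0 ≤ 1 + -(1 / ((n + 1 : ℕ) : ℝ)) := by
      by_contra! hneg
      have := mul_neg_of_pos_of_neg hn hneg
      rw [← e] at this
      linarith [n.cast_nonneg (α := ℝ)]
    have h1 : (n : ℝ) ^ (1 / 15 : ℝ) ≤ ((n + 1 : ℕ) : ℝ) ^ (1 / 15 : ℝ) *
        (1 + 1 / 15 * -(1 / ((n + 1 : ℕ) : ℝ))) := by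
      conv_lhs => rw [e]
      rw [Real.mul_rpow hn.le hpos]
      gcongr
    have h2 : ((n + 1 : ℕ) : ℝ) ^ (-(14 / 15) : ℝ) =
        ((n + 1 : ℕ) : ℝ) ^ (1 / 15 : ℝ) * (1 / ((n + 1 : ℕ) : ℝ)) := by
      rw [show (-(14 / 15) : ℝ) = 1 / 15 - 1 by norm_num, Real.rpow_sub_one hn.ne']
      ring
    rw [h2]
    linarith

lemma one_div_mul_sqrt_succ_le {m : ℕ} (hm : 0 < m) :
    1 / (((m + 1 : ℕ) : ℝ) * √((m + 1 : ℕ) : ℝ)) ≤ 2 * (1 / √(m : ℝ) - 1 / √((m + 1 : ℕ) : ℝ)) := by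
  set u := √(m : ℝ) with hu
  set v := √((m + 1 : ℕ) : ℝ) with hv
  have hu0 : 0 < u := Real.sqrt_pos.2 (by exact_mod_cast hm)
  have huv : u ≤ v := Real.sqrt_le_sqrt (by push_cast; linarith)
  have hv0 : 0 < v := hu0.trans_le huv
  have hu2 : u ^ 2 = m := Real.sq_sqrt (by positivity)
  have hv2 : v ^ 2 = (m + 1 : ℕ) := Real.sq_sqrt (by positivity)
  have hd : (v - u) * (v + u) = 1 := by
    have : v ^ 2 = u ^ 2 + 1 := by rw [hu2, hv2]; push_cast; ring
    linarith
  rw [← hv2]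
  have e : 1 / u - 1 / v = 1 / (u * v * (v + u)) := by
    field_simp
    linarith
  rw [e, mul_one_div, div_le_div_iff₀ (by positivity) (by positivity)]
  have : u * v * (v + u) ≤ v * v * (v + v) := by gcongr
  nlinarith

lemma summable_log_div_sq : Summable fun d : ℕ => Real.log d / (d : ℝ) ^ 2 := by
  refine Summable.of_nonneg_of_le (fun d => div_nonneg (Real.log_natCast_nonneg d) (by positivity))
    (fun d => ?_) ((Real.summable_nat_rpow.2 (show (-(3 / 2) : ℝ) < -1 by norm_num)).mul_left 2)
  rcases Nat.eq_zero_or_pos d with rfl | hd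
  · simp
  have hd' : (0 : ℝ) < d := by exact_mod_cast hd
  have h := Real.log_le_rpow_div hd'.le (show (0 : ℝ) < 1 / 2 by norm_num)
  rw [div_le_iff₀ (by positivity), mul_assoc, ← Real.rpow_natCast, ← Real.rpow_add hd']
  norm_num at h ⊢
  linarith

/-- The `d`-th term of the main term of the sum, divided by `x`. -/
noncomputable def mainTerm (x c : ℝ) (d : ℕ) : ℝ :=
  (Real.log x - 2 * Real.log d + c) / (d : ℝ) ^ 2

lemma hasSum_mainTerm (x c : ℝ) :
    HasSum (mainTerm x c)
      ((Real.log x + c) * (π ^ 2 / 6) - 2 * ∑' d : ℕ, Real.log d / (d : ℝ) ^ 2) := by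
  convert! (hasSum_zeta_two.mul_left (Real.log x + c)).sub
    (summable_log_div_sq.hasSum.mul_left 2) using 1
  ext d
  rw [mainTerm]
  ring

lemma abs_mainTerm_le {x c : ℝ} (hx : 0 < x) (hc : |c| ≤ 1) {d : ℕ} (hd : √x < d) :
    |mainTerm x c d| ≤ 5 / √√x * (1 / (d * √d)) := by
  have hd' : (0 : ℝ) < d := (Real.sqrt_nonneg x).trans_lt hd
  set w := √√x with hw
  have hw0 : 0 < w := Real.sqrt_pos.2 (Real.sqrt_pos.2 hx)
  have hw4 : w ^ 4 = x := by
    calc w ^ 4 = (w ^ 2) ^ 2 := by ring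
      _ = x := by rw [hw, Real.sq_sqrt (Real.sqrt_nonneg x), Real.sq_sqrt hx.le]
  set v := √(d : ℝ) with hv
  have hv0 : 0 < v := Real.sqrt_pos.2 hd'
  have hv2 : v ^ 2 = d := Real.sq_sqrt hd'.le
  have hwv : w ≤ v := Real.sqrt_le_sqrt hd.le
  have h1 : 1 ≤ v / w := by rwa [le_div_iff₀ hw0, one_mul]
  have h2 : Real.log x - 2 * Real.log d = -(4 * Real.log (v / w)) := by
    rw [Real.log_div hv0.ne' hw0.ne', ← hw4, ← hv2, Real.log_pow, Real.log_pow]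
    push_cast; ring
  have h3 := Real.log_nonneg h1
  have h4 := Real.log_le_sub_one_of_pos (show 0 < v / w by positivity)
  have h5 : |Real.log x - 2 * Real.log d + c| ≤ 5 * (v / w) := by
    rw [h2]
    rw [abs_le] at hc ⊢
    constructor <;> linarith
  rw [mainTerm, abs_div, abs_of_nonneg (show (0 : ℝ) ≤ (d : ℝ) ^ 2 by positivity),
    div_le_iff₀ (by positivity)]
  refine h5.trans (le_of_eq ?_)
  rw [← hv2]
  field_simp

lemma abs_hasSum_mainTerm_sub_le {N : ℕ} (hN : 0 < N) {c A : ℝ} (hc : |c| ≤ 1)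
    (hA : HasSum (mainTerm N c) A) :
    |∑ d ∈ Icc 1 (Nat.sqrt N), mainTerm N c d - A| ≤ 20 / √N := by
  set R := Nat.sqrt N with hR
  have hN' : (0 : ℝ) < N := by exact_mod_cast hN
  have hR0 : 0 < R := Nat.sqrt_pos.2 hN
  have hR' : (1 : ℝ) ≤ R := by exact_mod_cast hR0
  have hRN : √(N : ℝ) < R + 1 := by
    rw [Real.sqrt_lt' (by positivity)]
    exact_mod_cast Nat.lt_succ_sqrt' N
  set w := √√(N : ℝ) with hw
  have hw0 : 0 < w := Real.sqrt_pos.2 (Real.sqrt_pos.2 hN')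
  have hw2 : w ^ 2 = √(N : ℝ) := Real.sq_sqrt (Real.sqrt_nonneg _)
  have hpart : ∀ L ≥ R, |∑ d ∈ Icc 1 R, mainTerm N c d - ∑ d ∈ Icc 1 L, mainTerm N c d| ≤
      5 / w * (2 * (1 / √(R : ℝ) - 1 / √(L : ℝ))) := by
    intro L hL
    induction L, hL using Nat.le_induction with
    | base => simp
    | succ L hL ih =>
      rw [sum_Icc_succ_top (by omega)]
      have h1 := abs_mainTerm_le hN' hc (d := L + 1)
        (hRN.trans_le (by push_cast; gcongr))
      have h2 : 5 / w * (1 / (((L + 1 : ℕ) : ℝ) * √((L + 1 : ℕ) : ℝ))) ≤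
          5 / w * (2 * (1 / √(L : ℝ) - 1 / √((L + 1 : ℕ) : ℝ))) := by
        gcongr
        exact one_div_mul_sqrt_succ_le (by omega)
      have h3 := abs_sub (∑ d ∈ Icc 1 R, mainTerm N c d - ∑ d ∈ Icc 1 L, mainTerm N c d)
        (mainTerm N c (L + 1))
      rw [sub_sub] at h3
      refine h3.trans ((add_le_add ih (h1.trans h2)).trans (le_of_eq (by ring)))
  have hlim : Filter.Tendsto (fun L : ℕ => ∑ d ∈ Icc 1 L, mainTerm N c d) Filter.atTop (nhds A) := by
    refine ((Filter.tendsto_add_atTop_iff_nat 1).2 hA.tendsto_sum_nat).congr fun L => ?_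
    rw [range_eq_Ico, sum_eq_sum_Ico_succ_bot (by omega)]
    simp only [mainTerm, Nat.cast_zero]
    norm_num
    rfl
  refine le_of_tendsto (tendsto_const_nhds.sub hlim).abs ?_
  filter_upwards [Filter.eventually_ge_atTop R] with L hL
  refine (hpart L hL).trans ?_
  have h1 : w ≤ 2 * √(R : ℝ) := by
    refine abs_le_of_sq_le_sq' ?_ (by positivity) |>.2
    rw [hw2, mul_pow, Real.sq_sqrt (by positivity)]
    linarith
  have h2 : 1 / √(R : ℝ) ≤ 2 / w := by
    rw [div_le_div_iff₀ (by positivity) hw0]; linarith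
  have h3 : 0 ≤ 1 / √(L : ℝ) := by positivity
  calc 5 / w * (2 * (1 / √(R : ℝ) - 1 / √(L : ℝ))) ≤ 5 / w * (2 * (2 / w)) := by
        gcongr; linarith
    _ = 20 / w ^ 2 := by field_simp; norm_num
    _ = _ := by rw [hw2]

/-- `S(N) = ζ(2) N log N + ((2γ−1)ζ(2) − 2θ) N + O(√N)`, where
`S(N) = Σ_{a,b ≥ 1, ab ≤ N} τ(gcd(a,b))`, `γ` is the Euler–Mascheroni constant,
`ζ(2) = π²/6` and `θ = Σ_{d=1}^∞ (log d)/d²`. -/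
theorem divisor_gcd_sum_asymptotic :
    ∃ C : ℝ, 0 < C ∧ ∀ N : ℕ, 0 < N →
      |(∑ p ∈ ((Finset.Icc 1 N) ×ˢ (Finset.Icc 1 N)).filter (fun p => p.1 * p.2 ≤ N),
          ((Nat.gcd p.1 p.2).divisors.card : ℝ))
        - (π ^ 2 / 6) * N * Real.log N
        - ((2 * Real.eulerMascheroniConstant - 1) * (π ^ 2 / 6)
            - 2 * ∑' d : ℕ, Real.log d / (d : ℝ) ^ 2) * N|
      ≤ C * Real.sqrt N := by
  refine ⟨2270, by norm_num, fun N hN => ?_⟩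
  have hN' : (0 : ℝ) < N := by exact_mod_cast hN
  set c := 2 * Real.eulerMascheroniConstant - 1 with hc
  have hc1 : |c| ≤ 1 := by
    have := Real.one_half_lt_eulerMascheroniConstant
    have := Real.eulerMascheroniConstant_lt_two_thirds
    rw [abs_le]; constructor <;> linarith
  set R := Nat.sqrt N with hR
  have hRN : (R : ℝ) ^ 2 ≤ N := by exact_mod_cast Nat.sqrt_le' N
  have hterm : ∀ d ∈ Icc 1 R, |(divisorSum (N / d ^ 2) : ℝ) - N * mainTerm N c d| ≤
      150 * (N : ℝ) ^ (7 / 15 : ℝ) * (d : ℝ) ^ (-(14 / 15) : ℝ) := by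
    intro d hd
    obtain ⟨hd1, hdR⟩ := mem_Icc.1 hd
    have hd' : (0 : ℝ) < d := by exact_mod_cast hd1
    have hdN : (d : ℝ) ^ 2 ≤ N := le_trans (by gcongr) hRN
    have h := abs_divisorSum_floor_sub_le (x := (N : ℝ) / (d : ℝ) ^ 2)
      (by rwa [le_div_iff₀ (by positivity), one_mul])
    have e1 : ⌊(N : ℝ) / (d : ℝ) ^ 2⌋₊ = N / d ^ 2 := by
      rw [← Nat.floor_div_eq_div (K := ℝ)]; push_cast; rfl
    have e2 : (N : ℝ) / (d : ℝ) ^ 2 * (Real.log ((N : ℝ) / (d : ℝ) ^ 2) + c) =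
        N * mainTerm N c d := by
      rw [mainTerm, Real.log_div hN'.ne' (by positivity), Real.log_pow]
      push_cast; ring
    have e3 : ((N : ℝ) / (d : ℝ) ^ 2) ^ (7 / 15 : ℝ) =
        (N : ℝ) ^ (7 / 15 : ℝ) * (d : ℝ) ^ (-(14 / 15) : ℝ) := by
      rw [Real.div_rpow hN'.le (by positivity), ← Real.rpow_natCast, ← Real.rpow_mul hd'.le,
        Real.rpow_neg hd'.le, div_eq_mul_inv]
      norm_num
    rw [← hc, e1, e2, e3, ← mul_assoc] at h
    exact h
  have hsum : |∑ d ∈ Icc 1 R, (divisorSum (N / d ^ 2) : ℝ) -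
      N * ∑ d ∈ Icc 1 R, mainTerm N c d| ≤ 2250 * √N := by
    rw [mul_sum, ← sum_sub_distrib]
    refine (abs_sum_le_sum_abs _ _).trans ((sum_le_sum hterm).trans ?_)
    rw [← mul_sum]
    have hR1 : (R : ℝ) ^ (1 / 15 : ℝ) ≤ (N : ℝ) ^ (1 / 30 : ℝ) := by
      calc (R : ℝ) ^ (1 / 15 : ℝ) = ((R : ℝ) ^ 2) ^ (1 / 30 : ℝ) := by
            rw [← Real.rpow_natCast, ← Real.rpow_mul (by positivity)]; norm_num
        _ ≤ _ := by gcongr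
    calc 150 * (N : ℝ) ^ (7 / 15 : ℝ) * ∑ d ∈ Icc 1 R, (d : ℝ) ^ (-(14 / 15) : ℝ)
        ≤ 150 * (N : ℝ) ^ (7 / 15 : ℝ) * (15 * (N : ℝ) ^ (1 / 30 : ℝ)) := by
          gcongr
          exact (sum_Icc_rpow_neg_le R).trans (by gcongr)
      _ = 2250 * ((N : ℝ) ^ (7 / 15 : ℝ) * (N : ℝ) ^ (1 / 30 : ℝ)) := by ring
      _ = 2250 * √N := by
          rw [← Real.rpow_add hN', Real.sqrt_eq_rpow]; norm_num
  have htail := abs_hasSum_mainTerm_sub_le hN hc1 (hasSum_mainTerm N c)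
  rw [← hR] at htail
  set A := (Real.log N + c) * (π ^ 2 / 6) - 2 * ∑' d : ℕ, Real.log d / (d : ℝ) ^ 2 with hA
  have htail' : |N * (∑ d ∈ Icc 1 R, mainTerm N c d - A)| ≤ 20 * √N := by
    rw [abs_mul, Nat.abs_cast]
    calc N * |∑ d ∈ Icc 1 R, mainTerm N c d - A| ≤ N * (20 / √N) := by gcongr
      _ = 20 * (N / √N) := by ring
      _ = 20 * √N := by rw [Real.div_sqrt]
  have hS : (∑ p ∈ ((Finset.Icc 1 N) ×ˢ (Finset.Icc 1 N)).filter (fun p => p.1 * p.2 ≤ N),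
      ((Nat.gcd p.1 p.2).divisors.card : ℝ)) = ∑ d ∈ Icc 1 R, (divisorSum (N / d ^ 2) : ℝ) := by
    exact_mod_cast sum_card_divisors_gcd_eq N
  rw [hS]
  have e : ∑ d ∈ Icc 1 R, (divisorSum (N / d ^ 2) : ℝ) - (π ^ 2 / 6) * N * Real.log N
        - (c * (π ^ 2 / 6) - 2 * ∑' d : ℕ, Real.log d / (d : ℝ) ^ 2) * N =
      (∑ d ∈ Icc 1 R, (divisorSum (N / d ^ 2) : ℝ) - N * ∑ d ∈ Icc 1 R, mainTerm N c d) +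
        N * (∑ d ∈ Icc 1 R, mainTerm N c d - A) := by
    rw [hA]; ring
  rw [e]
  exact (abs_add_le _ _).trans (by linarith)
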